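/- arXiv:math/0312330 — 3 statements merged into one kernel-verified Lean document; each statement's English description precedes it below -/
import Mathlib

section
/- Let σ: A × B → k be a Hopf pairing between Hopf algebras A and B, and let φ: A → A be a Hopf algebra endomorphism. Define on the vector space A ⊗ B a product by (a ⊗ b)(a' ⊗ b') = σ(φ(a'_{(1)}), S(b_{(1)})) σ(a'_{(3)}, b_{(3)}) · (a a'_{(2)} ⊗ b_{(2)} b'). Then this product is associative with unit 1_A ⊗ 1_B. -/
open TensorProduct Coalgebra

/-- A Hopf pairing between two Hopf algebras `A` and `B` over a field `k`: a bilinear map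
`σ : A × B → k` satisfying `σ(a, bb') = σ(a₍₁₎, b) σ(a₍₂₎, b')`,
`σ(aa', b) = σ(a, b₍₂₎) σ(a', b₍₁₎)`, `σ(a, 1) = ε(a)` and `σ(1, b) = ε(b)`. -/
structure HopfPairing (k A B : Type) [Field k] [Ring A] [HopfAlgebra k A]
    [Ring B] [HopfAlgebra k B] where
  σ : A →ₗ[k] B →ₗ[k] k
  pair_mul_right : ∀ (a : A) (b b' : B),
    σ a (b * b') = LinearMap.mul' k k (TensorProduct.map (σ.flip b) (σ.flip b') (comul (R := k) a))
  pair_mul_left : ∀ (a a' : A) (b : B),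
    σ (a * a') b = LinearMap.mul' k k (TensorProduct.map (σ a') (σ a) (comul (R := k) b))
  pair_one_right : ∀ a : A, σ a 1 = counit (R := k) a
  pair_one_left : ∀ b : B, σ 1 b = counit (R := k) b
variable (k : Type) [Field k]

/-- The iterated comultiplication `(Δ ⊗ id) ∘ Δ : A → (A ⊗ A) ⊗ A`. -/
noncomputable def comul3 (A : Type) [Ring A] [HopfAlgebra k A] :
    A →ₗ[k] (A ⊗[k] A) ⊗[k] A :=
  (LinearMap.rTensor A (Coalgebra.comul (R := k) (A := A))) ∘ₗ Coalgebra.comul (R := k) (A := A)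

/-- `m` is the product of the twisted double `D(A,B;σ,φ)`: on pure tensors it is given by
`(a ⊗ b)(a' ⊗ b') = σ(φ(a'₍₁₎), S(b₍₁₎)) σ(a'₍₃₎, b₍₃₎) (a a'₍₂₎ ⊗ b₍₂₎ b')`,
expressed via arbitrary finite representations of the iterated comultiplications. -/
def IsTwistedDoubleMul {A B : Type} [Ring A] [HopfAlgebra k A] [Ring B] [HopfAlgebra k B]
    (p : HopfPairing k A B) (φ : A →ₐ[k] A)
    (m : (A ⊗[k] B) →ₗ[k] (A ⊗[k] B) →ₗ[k] (A ⊗[k] B)) : Prop :=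
  ∀ (a a' : A) (b b' : B) (ι κ : Type) (s : Finset ι) (t : Finset κ)
    (u v w : ι → A) (pb q r : κ → B),
    comul3 k A a' = ∑ i ∈ s, (u i ⊗ₜ[k] v i) ⊗ₜ[k] w i →
    comul3 k B b = ∑ j ∈ t, (pb j ⊗ₜ[k] q j) ⊗ₜ[k] r j →
    m (a ⊗ₜ[k] b) (a' ⊗ₜ[k] b') = ∑ i ∈ s, ∑ j ∈ t,
      (p.σ (φ (u i)) (HopfAlgebra.antipode (R := k) (pb j)) * p.σ (w i) (r j)) •
        ((a * v i) ⊗ₜ[k] (q j * b'))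

section Helpers

open LinearMap WithConv

variable {k}

section Coalg
variable {C : Type} [Ring C] [HopfAlgebra k C]

/-- convolution of functionals -/
noncomputable def cv (f g : C →ₗ[k] k) : C →ₗ[k] k :=
  LinearMap.mul' k k ∘ₗ TensorProduct.map f g ∘ₗ Coalgebra.comul

/-- `c ↦ f(c₁) c₂` -/
noncomputable def lact (f : C →ₗ[k] k) : C →ₗ[k] C :=
  (TensorProduct.lid k C).toLinearMap ∘ₗ LinearMap.rTensor C f ∘ₗ Coalgebra.comul

/-- `c ↦ c₁ g(c₂)` -/
noncomputable def ract (g : C →ₗ[k] k) : C →ₗ[k] C :=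
  (TensorProduct.rid k C).toLinearMap ∘ₗ LinearMap.lTensor C g ∘ₗ Coalgebra.comul

/-- `c ↦ f(c₁) c₂ g(c₃)` -/
noncomputable def act (f g : C →ₗ[k] k) : C →ₗ[k] C := lact f ∘ₗ ract g

/-- contraction of the outer legs -/
noncomputable def contr (f g : C →ₗ[k] k) : (C ⊗[k] C) ⊗[k] C →ₗ[k] C :=
  (TensorProduct.rid k C).toLinearMap ∘ₗ
    TensorProduct.map ((TensorProduct.lid k C).toLinearMap ∘ₗ LinearMap.rTensor C f) g

lemma act_eq_contr (f g : C →ₗ[k] k) (c : C) : act f g c = contr f g (comul3 k C c) := by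
  have h : lact f ∘ₗ (TensorProduct.rid k C).toLinearMap ∘ₗ LinearMap.lTensor C g
      = contr f g ∘ₗ LinearMap.rTensor C Coalgebra.comul := by
    ext x y
    simp [contr, lact]
  exact LinearMap.congr_fun h (Coalgebra.comul c)

lemma act_sum {ι : Type} (f g : C →ₗ[k] k) (c : C) (t : Finset ι) (p q r : ι → C)
    (h : comul3 k C c = ∑ j ∈ t, (p j ⊗ₜ[k] q j) ⊗ₜ[k] r j) :
    act f g c = ∑ j ∈ t, (f (p j) * g (r j)) • q j := by
  rw [act_eq_contr, h, map_sum]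
  refine Finset.sum_congr rfl fun j _ => ?_
  simp [contr, smul_smul, mul_comm]

lemma lact_lact (f₁ f₂ : C →ₗ[k] k) (c : C) : lact f₂ (lact f₁ c) = lact (cv f₁ f₂) c := by
  have h1 : lact f₂ ∘ₗ (TensorProduct.lid k C).toLinearMap ∘ₗ LinearMap.rTensor C f₁
      = ((TensorProduct.lid k C).toLinearMap ∘ₗ TensorProduct.map f₁
          ((TensorProduct.lid k C).toLinearMap ∘ₗ LinearMap.rTensor C f₂)) ∘ₗ
        LinearMap.lTensor C Coalgebra.comul := by
    ext x y
    simp [lact]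
  have h2 : (TensorProduct.lid k C).toLinearMap ∘ₗ LinearMap.rTensor C (cv f₁ f₂)
      = ((TensorProduct.lid k C).toLinearMap ∘ₗ TensorProduct.map f₁
          ((TensorProduct.lid k C).toLinearMap ∘ₗ LinearMap.rTensor C f₂)) ∘ₗ
        (TensorProduct.assoc k C C C).toLinearMap ∘ₗ LinearMap.rTensor C Coalgebra.comul := by
    have h3 : (TensorProduct.lid k C).toLinearMap ∘ₗ
          LinearMap.rTensor C (LinearMap.mul' k k ∘ₗ TensorProduct.map f₁ f₂)
        = ((TensorProduct.lid k C).toLinearMap ∘ₗ TensorProduct.map f₁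
          ((TensorProduct.lid k C).toLinearMap ∘ₗ LinearMap.rTensor C f₂)) ∘ₗ
        (TensorProduct.assoc k C C C).toLinearMap := by
      ext x y z
      simp [smul_smul, mul_comm]
    rw [← LinearMap.comp_assoc, ← h3, LinearMap.comp_assoc, ← LinearMap.rTensor_comp]
    rfl
  have e1 := LinearMap.congr_fun h1 (Coalgebra.comul c)
  have e2 := LinearMap.congr_fun h2 (Coalgebra.comul c)
  simp only [LinearMap.comp_apply, LinearEquiv.coe_coe, Coalgebra.coassoc_apply] at e1 e2
  exact e1.trans e2.symm

lemma ract_ract (g₁ g₂ : C →ₗ[k] k) (c : C) : ract g₂ (ract g₁ c) = ract (cv g₂ g₁) c := by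
  have h1 : ract g₂ ∘ₗ (TensorProduct.rid k C).toLinearMap ∘ₗ LinearMap.lTensor C g₁
      = ((TensorProduct.rid k C).toLinearMap ∘ₗ TensorProduct.map
          ((TensorProduct.rid k C).toLinearMap ∘ₗ LinearMap.lTensor C g₂) g₁) ∘ₗ
        LinearMap.rTensor C Coalgebra.comul := by
    ext x y
    simp [ract]
  have h2 : (TensorProduct.rid k C).toLinearMap ∘ₗ LinearMap.lTensor C (cv g₂ g₁)
      = ((TensorProduct.rid k C).toLinearMap ∘ₗ TensorProduct.map
          ((TensorProduct.rid k C).toLinearMap ∘ₗ LinearMap.lTensor C g₂) g₁) ∘ₗ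
        (TensorProduct.assoc k C C C).symm.toLinearMap ∘ₗ
          LinearMap.lTensor C Coalgebra.comul := by
    have h3 : (TensorProduct.rid k C).toLinearMap ∘ₗ
          LinearMap.lTensor C (LinearMap.mul' k k ∘ₗ TensorProduct.map g₂ g₁)
        = ((TensorProduct.rid k C).toLinearMap ∘ₗ TensorProduct.map
          ((TensorProduct.rid k C).toLinearMap ∘ₗ LinearMap.lTensor C g₂) g₁) ∘ₗ
        (TensorProduct.assoc k C C C).symm.toLinearMap := by
      ext x y z
      simp [smul_smul, mul_comm]
    rw [← LinearMap.comp_assoc, ← h3, LinearMap.comp_assoc, ← LinearMap.lTensor_comp]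
    rfl
  have e1 := LinearMap.congr_fun h1 (Coalgebra.comul c)
  have e2 := LinearMap.congr_fun h2 (Coalgebra.comul c)
  simp only [LinearMap.comp_apply, LinearEquiv.coe_coe, Coalgebra.coassoc_symm_apply] at e1 e2
  exact e1.trans e2.symm

lemma ract_lact (f g : C →ₗ[k] k) (c : C) : ract g (lact f c) = lact f (ract g c) := by
  have h1 : ract g ∘ₗ (TensorProduct.lid k C).toLinearMap ∘ₗ LinearMap.rTensor C f
      = ((TensorProduct.lid k C).toLinearMap ∘ₗ TensorProduct.map f
          ((TensorProduct.rid k C).toLinearMap ∘ₗ LinearMap.lTensor C g)) ∘ₗ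
        LinearMap.lTensor C Coalgebra.comul := by
    ext x y
    simp [ract]
  have h3 : contr f g = ((TensorProduct.lid k C).toLinearMap ∘ₗ TensorProduct.map f
          ((TensorProduct.rid k C).toLinearMap ∘ₗ LinearMap.lTensor C g)) ∘ₗ
        (TensorProduct.assoc k C C C).toLinearMap := by
    ext x y z
    simp [contr, smul_smul, mul_comm]
  have e1 := LinearMap.congr_fun h1 (Coalgebra.comul c)
  have e2 := act_eq_contr f g c
  rw [h3] at e2
  simp only [LinearMap.comp_apply, LinearEquiv.coe_coe, comul3, Coalgebra.coassoc_apply] at e1 e2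
  exact e1.trans e2.symm

lemma act_act (f₁ f₂ g₁ g₂ : C →ₗ[k] k) (c : C) :
    act f₂ g₂ (act f₁ g₁ c) = act (cv f₁ f₂) (cv g₂ g₁) c := by
  simp only [act, LinearMap.comp_apply]
  rw [ract_lact, ract_ract, lact_lact]

lemma act_counit (c : C) : act (Coalgebra.counit (R := k)) Coalgebra.counit c = c := by
  simp [act, lact, ract]

lemma exists_comul3 (c : C) : ∃ (n : Type) (t : Finset n) (p q r : n → C),
    comul3 k C c = ∑ j ∈ t, (p j ⊗ₜ[k] q j) ⊗ₜ[k] r j := by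
  have : ∀ x : (C ⊗[k] C) ⊗[k] C, ∃ (n : ℕ) (p q r : Fin n → C),
      x = ∑ j, (p j ⊗ₜ[k] q j) ⊗ₜ[k] r j := by
    intro x
    induction x using TensorProduct.induction_on with
    | zero => exact ⟨0, Fin.elim0, Fin.elim0, Fin.elim0, by simp⟩
    | tmul y z =>
      induction y using TensorProduct.induction_on with
      | zero => exact ⟨0, Fin.elim0, Fin.elim0, Fin.elim0, by simp⟩
      | tmul u v => exact ⟨1, fun _ => u, fun _ => v, fun _ => z, by simp⟩
      | add a b ha hb =>
        obtain ⟨n, p, q, r, h⟩ := ha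
        obtain ⟨n', p', q', r', h'⟩ := hb
        exact ⟨n + n', Fin.append p p', Fin.append q q', Fin.append r r', by
          rw [TensorProduct.add_tmul, h, h', Fin.sum_univ_add]; simp⟩
    | add a b ha hb =>
      obtain ⟨n, p, q, r, h⟩ := ha
      obtain ⟨n', p', q', r', h'⟩ := hb
      exact ⟨n + n', Fin.append p p', Fin.append q q', Fin.append r r', by
        rw [h, h', Fin.sum_univ_add]; simp⟩
  obtain ⟨n, p, q, r, h⟩ := this (comul3 k C c)
  exact ⟨Fin n, Finset.univ, p, q, r, h⟩

lemma comul3_mul (a b : C) : comul3 k C (a * b) = comul3 k C a * comul3 k C b := by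
  have : ∀ x y : C ⊗[k] C, LinearMap.rTensor C (Coalgebra.comul (R := k) (A := C)) (x * y)
      = LinearMap.rTensor C (Coalgebra.comul (R := k) (A := C)) x *
        LinearMap.rTensor C (Coalgebra.comul (R := k) (A := C)) y :=
    fun x y => map_mul (Algebra.TensorProduct.map (Bialgebra.comulAlgHom k C) (AlgHom.id k C)) x y
  simp only [comul3, LinearMap.comp_apply, Bialgebra.comul_mul, this]

lemma comul3_one : comul3 k C (1 : C) = (1 ⊗ₜ[k] 1) ⊗ₜ[k] 1 := by
  simp [comul3, Algebra.TensorProduct.one_def]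

lemma comul3_mul_sum {ι κ : Type} (a b : C) (s : Finset ι) (t : Finset κ) (u v w : ι → C)
    (p q r : κ → C) (ha : comul3 k C a = ∑ i ∈ s, (u i ⊗ₜ[k] v i) ⊗ₜ[k] w i)
    (hb : comul3 k C b = ∑ j ∈ t, (p j ⊗ₜ[k] q j) ⊗ₜ[k] r j) :
    comul3 k C (a * b) = ∑ x ∈ s ×ˢ t,
      ((u x.1 * p x.2) ⊗ₜ[k] (v x.1 * q x.2)) ⊗ₜ[k] (w x.1 * r x.2) := by
  rw [comul3_mul, ha, hb, Finset.sum_mul_sum, Finset.sum_product]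
  simp

lemma comul_antipode' (c : C) : Coalgebra.comul (R := k) (HopfAlgebra.antipode k c)
    = TensorProduct.map (HopfAlgebra.antipode k) (HopfAlgebra.antipode k)
      (TensorProduct.comm k C C (Coalgebra.comul c)) := by
  let S : C →ₗ[k] C := HopfAlgebra.antipode k
  let i1 : C →ₐ[k] C ⊗[k] C := Algebra.TensorProduct.includeLeft
  let i2 : C →ₐ[k] C ⊗[k] C := Algebra.TensorProduct.includeRight
  let G : C →ₗ[k] C ⊗[k] C :=
    TensorProduct.map S S ∘ₗ (TensorProduct.comm k C C).toLinearMap ∘ₗ Coalgebra.comul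
  have hD : (toConv (Coalgebra.comul (R := k) (A := C)) : WithConv (C →ₗ[k] C ⊗[k] C))
      = toConv i1.toLinearMap * toConv i2.toLinearMap := by
    ext c
    rw [(ℛ k c).convMul_apply]
    simp [i1, i2, (ℛ k c).eq]
  have hG : (toConv G : WithConv (C →ₗ[k] C ⊗[k] C))
      = toConv (i2.toLinearMap ∘ₗ S) * toConv (i1.toLinearMap ∘ₗ S) := by
    ext c
    rw [(ℛ k c).convMul_apply]
    simp [i1, i2, G, ← (ℛ k c).eq]
  have hi : ∀ i : C →ₐ[k] C ⊗[k] C, (toConv (i.toLinearMap ∘ₗ S) * toConv i.toLinearMap :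
      WithConv (C →ₗ[k] C ⊗[k] C)) = 1 := by
    intro i
    ext c
    rw [(ℛ k c).convMul_apply]
    have := congrArg i (HopfAlgebra.sum_antipode_mul_eq_algebraMap_counit (ℛ k c))
    simpa [S] using this
  have hl : (toConv G * toConv (Coalgebra.comul (R := k) (A := C)) :
      WithConv (C →ₗ[k] C ⊗[k] C)) = 1 := by
    rw [hG, hD, mul_assoc, ← mul_assoc (toConv (i1.toLinearMap ∘ₗ S)), hi, one_mul, hi]
  have := left_inv_eq_right_inv hl (LinearMap.comul_right_inv (R := k) (C := C))
  have := WithConv.toConv_injective this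
  exact (LinearMap.congr_fun this c).symm

end Coalg

section Pair
variable {A B : Type} [Ring A] [HopfAlgebra k A] [Ring B] [HopfAlgebra k B]
    (p : HopfPairing k A B) (φ : A →ₐ[k] A)

/-- `τ(a,b) = σ(φ a, S b)` -/
noncomputable def tau : A →ₗ[k] B →ₗ[k] k :=
  p.σ.compl₁₂ φ.toLinearMap (HopfAlgebra.antipode k)

lemma tau_apply (a : A) (b : B) : tau p φ a b = p.σ (φ a) (HopfAlgebra.antipode k b) := rfl

lemma sig_mul_left (a a' : A) : p.σ (a * a') = cv (p.σ a') (p.σ a) := by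
  ext b
  exact p.pair_mul_left a a' b

lemma sig_mul_right (b b' : B) : p.σ.flip (b * b') = cv (p.σ.flip b) (p.σ.flip b') := by
  ext a
  exact p.pair_mul_right a b b'

lemma tau_mul_left (a a' : A) : tau p φ (a * a') = cv (tau p φ a) (tau p φ a') := by
  ext b
  rw [tau_apply, map_mul, p.pair_mul_left, comul_antipode']
  simp only [cv, LinearMap.comp_apply]
  have h : LinearMap.mul' k k ∘ₗ TensorProduct.map (p.σ (φ a')) (p.σ (φ a)) ∘ₗ
      TensorProduct.map (HopfAlgebra.antipode k) (HopfAlgebra.antipode k) ∘ₗ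
      (TensorProduct.comm k B B).toLinearMap
      = LinearMap.mul' k k ∘ₗ TensorProduct.map (tau p φ a) (tau p φ a') := by
    ext x y
    simp [tau_apply, mul_comm]
  exact LinearMap.congr_fun h (Coalgebra.comul b)

lemma tau_mul_right (hφc : ∀ a : A, Coalgebra.comul (R := k) (φ a)
      = TensorProduct.map φ.toLinearMap φ.toLinearMap (Coalgebra.comul a)) (b b' : B) :
    (tau p φ).flip (b * b') = cv ((tau p φ).flip b') ((tau p φ).flip b) := by
  ext a
  rw [LinearMap.flip_apply, tau_apply, HopfAlgebra.antipode_mul_antidistrib, p.pair_mul_right, hφc]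
  simp only [cv, LinearMap.comp_apply]
  rw [← LinearMap.comp_apply (TensorProduct.map _ _), ← TensorProduct.map_comp]
  rfl

variable (m : (A ⊗[k] B) →ₗ[k] (A ⊗[k] B) →ₗ[k] (A ⊗[k] B))
    (hm : IsTwistedDoubleMul k p φ m)
include hm

lemma m_left (a a' : A) (b b' : B) {ι : Type} (s : Finset ι) (u v w : ι → A)
    (h : comul3 k A a' = ∑ i ∈ s, (u i ⊗ₜ[k] v i) ⊗ₜ[k] w i) :
    m (a ⊗ₜ[k] b) (a' ⊗ₜ[k] b') = ∑ i ∈ s,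
      (a * v i) ⊗ₜ[k] (act (tau p φ (u i)) (p.σ (w i)) b * b') := by
  obtain ⟨κ, t, x, y, z, hb⟩ := exists_comul3 (k := k) b
  rw [hm a a' b b' ι κ s t u v w x y z h hb]
  refine Finset.sum_congr rfl fun i _ => ?_
  rw [act_sum _ _ b t x y z hb, Finset.sum_mul, TensorProduct.tmul_sum]
  refine Finset.sum_congr rfl fun j _ => ?_
  rw [smul_mul_assoc, TensorProduct.tmul_smul, tau_apply]

lemma m_right (a a' : A) (b b' : B) {κ : Type} (t : Finset κ) (x y z : κ → B)
    (h : comul3 k B b = ∑ j ∈ t, (x j ⊗ₜ[k] y j) ⊗ₜ[k] z j) :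
    m (a ⊗ₜ[k] b) (a' ⊗ₜ[k] b') = ∑ j ∈ t,
      (a * act ((tau p φ).flip (x j)) (p.σ.flip (z j)) a') ⊗ₜ[k] (y j * b') := by
  obtain ⟨ι, s, u, v, w, ha⟩ := exists_comul3 (k := k) a'
  rw [hm a a' b b' ι κ s t u v w x y z ha h, Finset.sum_comm]
  refine Finset.sum_congr rfl fun j _ => ?_
  rw [act_sum _ _ a' s u v w ha, Finset.mul_sum, TensorProduct.sum_tmul]
  refine Finset.sum_congr rfl fun j _ => ?_
  rw [mul_smul_comm, TensorProduct.smul_tmul', LinearMap.flip_apply, LinearMap.flip_apply,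
    tau_apply]

lemma m_mul_right (a a' x : A) (b b' : B) {ι : Type} (s : Finset ι) (u v w : ι → A)
    (h : comul3 k A a' = ∑ i ∈ s, (u i ⊗ₜ[k] v i) ⊗ₜ[k] w i) :
    m (a ⊗ₜ[k] b) ((a' * x) ⊗ₜ[k] b') = ∑ i ∈ s,
      m ((a * v i) ⊗ₜ[k] act (tau p φ (u i)) (p.σ (w i)) b) (x ⊗ₜ[k] b') := by
  obtain ⟨κ, t, u', v', w', hx⟩ := exists_comul3 (k := k) x
  rw [m_left p φ m hm a (a' * x) b b' _ _ _ _ (comul3_mul_sum a' x s t u v w u' v' w' h hx),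
    Finset.sum_product]
  refine Finset.sum_congr rfl fun i _ => ?_
  rw [m_left p φ m hm _ x _ b' t u' v' w' hx]
  refine Finset.sum_congr rfl fun j _ => ?_
  rw [act_act, tau_mul_left, sig_mul_left, mul_assoc]

lemma m_mul_left (hφc : ∀ a : A, Coalgebra.comul (R := k) (φ a)
      = TensorProduct.map φ.toLinearMap φ.toLinearMap (Coalgebra.comul a))
    (a a' : A) (b c b' : B) {κ : Type} (t : Finset κ) (x y z : κ → B)
    (h : comul3 k B c = ∑ j ∈ t, (x j ⊗ₜ[k] y j) ⊗ₜ[k] z j) :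
    m (a ⊗ₜ[k] (b * c)) (a' ⊗ₜ[k] b') = ∑ j ∈ t,
      m (a ⊗ₜ[k] b) (act ((tau p φ).flip (x j)) (p.σ.flip (z j)) a' ⊗ₜ[k] (y j * b')) := by
  obtain ⟨ι, s, x', y', z', hb⟩ := exists_comul3 (k := k) b
  rw [m_right p φ m hm a a' (b * c) b' _ _ _ _ (comul3_mul_sum b c s t x' y' z' x y z hb h),
    Finset.sum_product, Finset.sum_comm]
  refine Finset.sum_congr rfl fun i _ => ?_
  rw [m_right p φ m hm _ _ b _ s x' y' z' hb]
  refine Finset.sum_congr rfl fun j _ => ?_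
  rw [act_act, tau_mul_right p φ hφc, sig_mul_right, mul_assoc]

end Pair

end Helpers

/-- The twisted double product on `A ⊗ B` is associative with unit `1_A ⊗ 1_B`. -/
theorem twistedDouble_assoc_unital {A B : Type} [Ring A] [HopfAlgebra k A]
    [Ring B] [HopfAlgebra k B] (p : HopfPairing k A B) (φ : A →ₐ[k] A)
    (hφc : ∀ a : A, Coalgebra.comul (R := k) (φ a)
      = TensorProduct.map φ.toLinearMap φ.toLinearMap (Coalgebra.comul a))
    (hφe : ∀ a : A, Coalgebra.counit (R := k) (φ a) = Coalgebra.counit (R := k) a)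
    (m : (A ⊗[k] B) →ₗ[k] (A ⊗[k] B) →ₗ[k] (A ⊗[k] B))
    (hm : IsTwistedDoubleMul k p φ m) :
    (∀ x y z : A ⊗[k] B, m (m x y) z = m x (m y z)) ∧
    (∀ x : A ⊗[k] B, m ((1 : A) ⊗ₜ[k] (1 : B)) x = x ∧ m x ((1 : A) ⊗ₜ[k] (1 : B)) = x) := by
  have key : ∀ (a a' a'' : A) (b b' b'' : B),
      m (m (a ⊗ₜ[k] b) (a' ⊗ₜ[k] b')) (a'' ⊗ₜ[k] b'')
        = m (a ⊗ₜ[k] b) (m (a' ⊗ₜ[k] b') (a'' ⊗ₜ[k] b'')) := by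
    intro a a' a'' b b' b''
    obtain ⟨ι, s, u, v, w, ha⟩ := exists_comul3 (k := k) a'
    obtain ⟨κ, t, x, y, z, hb⟩ := exists_comul3 (k := k) b'
    rw [m_left p φ m hm a a' b b' s u v w ha, m_right p φ m hm a' a'' b' b'' t x y z hb,
      map_sum, map_sum, LinearMap.sum_apply]
    simp_rw [m_mul_right p φ m hm a a' _ b _ s u v w ha,
      m_mul_left p φ m hm hφc _ a'' _ b' b'' t x y z hb]
    exact Finset.sum_comm
  refine ⟨fun x y z => ?_, fun x => ⟨?_, ?_⟩⟩
  · induction x using TensorProduct.induction_on with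
    | zero => simp
    | add x x' h h' => simp only [map_add, LinearMap.add_apply, h, h']
    | tmul a b =>
      induction y using TensorProduct.induction_on with
      | zero => simp
      | add x x' h h' => simp only [map_add, LinearMap.add_apply, h, h']
      | tmul a' b' =>
        induction z using TensorProduct.induction_on with
        | zero => simp
        | add x x' h h' => simp only [map_add, h, h']
        | tmul a'' b'' => exact key a a' a'' b b' b''
  · induction x using TensorProduct.induction_on with
    | zero => simp
    | add x x' h h' => simp only [map_add, h, h']
    | tmul a b =>
      have e1 : (tau p φ).flip 1 = Coalgebra.counit := by
        ext a
        simp [tau_apply, p.pair_one_right, hφe]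
      have e2 : p.σ.flip 1 = Coalgebra.counit := by
        ext a
        simp [p.pair_one_right]
      rw [m_right p φ m hm 1 a 1 b (Finset.univ : Finset Unit) (fun _ => 1) (fun _ => 1)
        (fun _ => 1) (by simp [comul3_one])]
      simp [e1, e2, act_counit]
  · induction x using TensorProduct.induction_on with
    | zero => simp
    | add x x' h h' => simp only [map_add, LinearMap.add_apply, h, h']
    | tmul a b =>
      have e1 : tau p φ 1 = Coalgebra.counit := by
        ext a
        simp [tau_apply, p.pair_one_left]
      have e2 : p.σ 1 = Coalgebra.counit := by
        ext a
        simp [p.pair_one_left]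
      rw [m_left p φ m hm a 1 b 1 (Finset.univ : Finset Unit) (fun _ => 1) (fun _ => 1)
        (fun _ => 1) (by simp [comul3_one])]
      simp [e1, e2, act_counit]
end

section
/- Let σ: A × B → k be a Hopf pairing, φ: π → Aut_Hopf(A) a group action by Hopf automorphisms, and D(A,B;σ,φ_α) the twisted double algebras. Define Δ_{α,β}(a⊗b) = (φ_β(a_{(1)}) ⊗ b_{(1)}) ⊗ (a_{(2)} ⊗ b_{(2)}). Then Δ_{α,β}: D(A,B;σ,φ_{αβ}) → D(A,B;σ,φ_α) ⊗ D(A,B;σ,φ_β) is an algebra homomorphism. -/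
open TensorProduct Coalgebra

variable (k : Type) [Field k]

section Abstract

variable {C : Type} [AddCommGroup C] [Module k C] [Coalgebra k C]

lemma mm (f g f2 g2 : C →ₗ[k] C) (t : C ⊗[k] C) : TensorProduct.map f g (TensorProduct.map f2 g2 t)
    = TensorProduct.map (f ∘ₗ f2) (g ∘ₗ g2) t := by
  rw [TensorProduct.map_comp]; rfl

noncomputable def actL (f : C →ₗ[k] k) : C →ₗ[k] C :=
  (TensorProduct.lid k C).toLinearMap ∘ₗ LinearMap.rTensor C f ∘ₗ comul (R := k)

noncomputable def actR (f : C →ₗ[k] k) : C →ₗ[k] C :=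
  (TensorProduct.rid k C).toLinearMap ∘ₗ LinearMap.lTensor C f ∘ₗ comul (R := k)

lemma comul_actL (f : C →ₗ[k] k) (c : C) :
    comul (R := k) (actL k f c) = TensorProduct.map (actL k f) LinearMap.id (comul (R := k) c) := by
  have h := congrArg ((TensorProduct.lid k (C ⊗[k] C)).toLinearMap ∘ₗ
    LinearMap.rTensor (C ⊗[k] C) f) (coassoc_apply (R := k) c)
  have h1 : ∀ t : C ⊗[k] C, ((TensorProduct.lid k (C ⊗[k] C)).toLinearMap ∘ₗ
    LinearMap.rTensor (C ⊗[k] C) f) (LinearMap.lTensor C comul t)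
      = comul (R := k) (TensorProduct.lid k C (LinearMap.rTensor C f t)) := by
    intro t
    induction t with
    | zero => simp
    | tmul x y => simp
    | add x y hx hy => simp only [map_add, hx, hy]
  have h2 : ∀ (t : C ⊗[k] C) (z : C), ((TensorProduct.lid k (C ⊗[k] C)).toLinearMap ∘ₗ
    LinearMap.rTensor (C ⊗[k] C) f) (TensorProduct.assoc k C C C (t ⊗ₜ z))
      = (TensorProduct.lid k C (LinearMap.rTensor C f t)) ⊗ₜ z := by
    intro t z
    induction t with
    | zero => simp
    | tmul x y => simp [TensorProduct.smul_tmul']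
    | add x y hx hy => simp only [map_add, hx, hy, TensorProduct.add_tmul]
  have h3 : ∀ t : C ⊗[k] C, ((TensorProduct.lid k (C ⊗[k] C)).toLinearMap ∘ₗ
    LinearMap.rTensor (C ⊗[k] C) f) (TensorProduct.assoc k C C C (LinearMap.rTensor C comul t))
      = TensorProduct.map (actL k f) LinearMap.id t := by
    intro t
    induction t with
    | zero => simp
    | tmul x y => rw [LinearMap.rTensor_tmul, h2]; rfl
    | add x y hx hy => simp only [map_add, hx, hy]
  rw [h1, h3] at h
  exact h.symm

lemma comul_actR (f : C →ₗ[k] k) (c : C) :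
    comul (R := k) (actR k f c) = TensorProduct.map LinearMap.id (actR k f) (comul (R := k) c) := by
  have h := congrArg ((TensorProduct.rid k (C ⊗[k] C)).toLinearMap ∘ₗ
    LinearMap.lTensor (C ⊗[k] C) f) (coassoc_symm_apply (R := k) c)
  have h1 : ∀ t : C ⊗[k] C, ((TensorProduct.rid k (C ⊗[k] C)).toLinearMap ∘ₗ
    LinearMap.lTensor (C ⊗[k] C) f) (LinearMap.rTensor C comul t)
      = comul (R := k) (TensorProduct.rid k C (LinearMap.lTensor C f t)) := by
    intro t
    induction t with
    | zero => simp
    | tmul x y => simp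
    | add x y hx hy => simp only [map_add, hx, hy]
  have h2 : ∀ (t : C ⊗[k] C) (z : C), ((TensorProduct.rid k (C ⊗[k] C)).toLinearMap ∘ₗ
    LinearMap.lTensor (C ⊗[k] C) f) ((TensorProduct.assoc k C C C).symm (z ⊗ₜ t))
      = z ⊗ₜ (TensorProduct.rid k C (LinearMap.lTensor C f t)) := by
    intro t z
    induction t with
    | zero => simp
    | tmul x y => simp
    | add x y hx hy => simp only [map_add, hx, hy, TensorProduct.tmul_add]
  have h3 : ∀ t : C ⊗[k] C, ((TensorProduct.rid k (C ⊗[k] C)).toLinearMap ∘ₗ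
    LinearMap.lTensor (C ⊗[k] C) f) ((TensorProduct.assoc k C C C).symm (LinearMap.lTensor C comul t))
      = TensorProduct.map LinearMap.id (actR k f) t := by
    intro t
    induction t with
    | zero => simp
    | tmul x y => rw [LinearMap.lTensor_tmul, h2]; rfl
    | add x y hx hy => simp only [map_add, hx, hy]
  rw [h1, h3] at h
  exact h.symm

lemma map_actR_comul (g : C →ₗ[k] k) (c : C) :
    TensorProduct.map (actR k g) LinearMap.id (comul (R := k) c) =
      TensorProduct.map LinearMap.id (actL k g) (comul (R := k) c) := by
  let T : C ⊗[k] (C ⊗[k] C) →ₗ[k] C ⊗[k] C :=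
    LinearMap.lTensor C ((TensorProduct.lid k C).toLinearMap ∘ₗ LinearMap.rTensor C g)
  have h := congrArg T (coassoc_apply (R := k) c)
  have h1 : ∀ t : C ⊗[k] C, T (LinearMap.lTensor C comul t)
      = TensorProduct.map LinearMap.id (actL k g) t := by
    intro t
    induction t with
    | zero => simp
    | tmul x y => simp [T, actL]
    | add x y hx hy => simp only [map_add, hx, hy]
  have h2 : ∀ (t : C ⊗[k] C) (z : C), T (TensorProduct.assoc k C C C (t ⊗ₜ z))
      = (TensorProduct.rid k C (LinearMap.lTensor C g t)) ⊗ₜ z := by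
    intro t z
    induction t with
    | zero => simp
    | tmul x y => simp [T, TensorProduct.smul_tmul']
    | add x y hx hy => simp only [map_add, hx, hy, TensorProduct.add_tmul]
  have h3 : ∀ t : C ⊗[k] C, T (TensorProduct.assoc k C C C (LinearMap.rTensor C comul t))
      = TensorProduct.map (actR k g) LinearMap.id t := by
    intro t
    induction t with
    | zero => simp
    | tmul x y => rw [LinearMap.rTensor_tmul, h2]; rfl
    | add x y hx hy => simp only [map_add, hx, hy]
  rw [h1, h3] at h
  exact h

lemma actL_actL (g h : C →ₗ[k] k)
    (hgh : ∀ c, LinearMap.mul' k k (TensorProduct.map g h (comul (R := k) c))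
      = counit (R := k) c) (c : C) : actL k h (actL k g c) = c := by
  have e : ∀ x : C, h (actL k g x) = counit (R := k) x := by
    intro x
    rw [← hgh]
    simp only [actL, LinearMap.comp_apply]
    induction comul (R := k) x with
    | zero => simp
    | tmul x y => simp
    | add x y hx hy => simp only [map_add, hx, hy]
  have e2 : h ∘ₗ actL k g = counit (R := k) := LinearMap.ext e
  rw [actL, LinearMap.comp_apply, LinearMap.comp_apply, comul_actL]
  have e3 : LinearMap.rTensor C h (TensorProduct.map (actL k g) LinearMap.id (comul (R := k) c))
      = LinearMap.rTensor C (counit (R := k)) (comul (R := k) c) := by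
    rw [← e2, LinearMap.rTensor, LinearMap.rTensor, ← LinearMap.comp_id (LinearMap.id (M := C)),
      TensorProduct.map_comp, LinearMap.comp_id]
    rfl
  rw [e3, rTensor_counit_comul]; simp

lemma key (f g h l : C →ₗ[k] k)
    (hgh : ∀ c, LinearMap.mul' k k (TensorProduct.map g h (comul (R := k) c))
      = counit (R := k) c) (c : C) :
    comul (R := k) (actL k f (actR k l c)) =
      TensorProduct.map (actL k f ∘ₗ actR k g) (actR k l ∘ₗ actL k h) (comul (R := k) c) := by
  have e : actL k h ∘ₗ actL k g = LinearMap.id := LinearMap.ext (actL_actL k g h hgh)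
  have e1 : TensorProduct.map (actL k f ∘ₗ actR k g) (actR k l ∘ₗ actL k h)
      = TensorProduct.map (actL k f) (actR k l ∘ₗ actL k h) ∘ₗ
        TensorProduct.map (actR k g) LinearMap.id := by
    rw [← TensorProduct.map_comp, LinearMap.comp_id]
  rw [e1, LinearMap.comp_apply, map_actR_comul, mm,
    LinearMap.comp_assoc, e, comul_actL, comul_actR, mm]
  simp

lemma actL_actR (f l : C →ₗ[k] k) (c : C) :
    actL k f (actR k l c) = actR k l (actL k f c) := by
  have h : ∀ x, actL k f x =
      TensorProduct.lid k C (LinearMap.rTensor C f (comul (R := k) x)) := fun _ => rfl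
  rw [h, h, comul_actR]
  induction comul (R := k) c with
  | zero => simp
  | tmul x y => simp
  | add x y hx hy => simp only [map_add, hx, hy]

lemma actL_map (Φ : C →ₗ[k] C)
    (hΦ : ∀ c, comul (R := k) (Φ c) = TensorProduct.map Φ Φ (comul (R := k) c))
    (f : C →ₗ[k] k) (c : C) : actL k f (Φ c) = Φ (actL k (f ∘ₗ Φ) c) := by
  simp only [actL, LinearMap.comp_apply, hΦ]
  induction comul (R := k) c with
  | zero => simp
  | tmul x y => simp
  | add x y hx hy => simp only [map_add, hx, hy]

lemma actR_map (Φ : C →ₗ[k] C)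
    (hΦ : ∀ c, comul (R := k) (Φ c) = TensorProduct.map Φ Φ (comul (R := k) c))
    (f : C →ₗ[k] k) (c : C) : actR k f (Φ c) = Φ (actR k (f ∘ₗ Φ) c) := by
  simp only [actR, LinearMap.comp_apply, hΦ]
  induction comul (R := k) c with
  | zero => simp
  | tmul x y => simp
  | add x y hx hy => simp only [map_add, hx, hy]

lemma actL_sum (f : C →ₗ[k] k) (c : C) {ι : Type} (s : Finset ι) (u v : ι → C)
    (h : comul (R := k) c = ∑ i ∈ s, u i ⊗ₜ[k] v i) :
    actL k f c = ∑ i ∈ s, f (u i) • v i := by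
  simp [actL, h]

lemma actR_sum (f : C →ₗ[k] k) (c : C) {ι : Type} (s : Finset ι) (u v : ι → C)
    (h : comul (R := k) c = ∑ i ∈ s, u i ⊗ₜ[k] v i) :
    actR k f c = ∑ i ∈ s, f (v i) • u i := by
  simp [actR, h]

end Abstract

section Conc

variable {A B : Type} [Ring A] [HopfAlgebra k A] [Ring B] [HopfAlgebra k B]

lemma comul_tmul_sum (a : A) (b : B) {ι κ : Type} (s : Finset ι) (t : Finset κ)
    (u v : ι → A) (pb q : κ → B)
    (ha : comul (R := k) a = ∑ i ∈ s, u i ⊗ₜ[k] v i)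
    (hb : comul (R := k) b = ∑ j ∈ t, pb j ⊗ₜ[k] q j) :
    comul (R := k) (a ⊗ₜ[k] b) =
      ∑ x ∈ s ×ˢ t, (u x.1 ⊗ₜ[k] pb x.2) ⊗ₜ[k] (v x.1 ⊗ₜ[k] q x.2) := by
  rw [TensorProduct.comul_tmul, ha, hb, Finset.sum_product]
  simp only [TensorProduct.sum_tmul, TensorProduct.tmul_sum, map_sum,
    TensorProduct.AlgebraTensorModule.tensorTensorTensorComm_tmul]
  try rw [Finset.sum_comm]

noncomputable def tauF (p : HopfPairing k A B) : A ⊗[k] B →ₗ[k] k := TensorProduct.lift p.σ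

noncomputable def sF (p : HopfPairing k A B) (φ : A →ₐ[k] A) : A ⊗[k] B →ₗ[k] k :=
  TensorProduct.lift p.σ ∘ₗ TensorProduct.map φ.toLinearMap (HopfAlgebra.antipode k)

noncomputable def mulAB (a : A) (b : B) : A ⊗[k] B →ₗ[k] A ⊗[k] B :=
  TensorProduct.map (LinearMap.mulLeft k a) (LinearMap.mulRight k b)

lemma comul3_sum (a : A) : comul3 k A a = ∑ x ∈ (ℛ k a).index.sigma
      (fun i => (ℛ k ((ℛ k a).left i)).index),
    ((ℛ k ((ℛ k a).left x.1)).left x.2 ⊗ₜ[k] (ℛ k ((ℛ k a).left x.1)).right x.2)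
      ⊗ₜ[k] (ℛ k a).right x.1 := by
  rw [comul3, LinearMap.comp_apply]
  conv_lhs => rw [← (ℛ k a).eq]
  rw [map_sum, Finset.sum_sigma]
  refine Finset.sum_congr rfl fun i _ => ?_
  rw [LinearMap.rTensor_tmul]
  conv_lhs => rw [← (ℛ k ((ℛ k a).left i)).eq]
  rw [TensorProduct.sum_tmul]

lemma m_eq (p : HopfPairing k A B) (φ : A →ₐ[k] A)
    (m : (A ⊗[k] B) →ₗ[k] (A ⊗[k] B) →ₗ[k] (A ⊗[k] B))
    (hm : IsTwistedDoubleMul k p φ m) (a a' : A) (b b' : B) :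
    m (a ⊗ₜ b) (a' ⊗ₜ b') =
      mulAB k a b' (actL k (sF k p φ) (actR k (tauF k p) (a' ⊗ₜ b))) := by
  rw [hm a a' b b' _ _ _ _ _ _ _ _ _ _ (comul3_sum k a') (comul3_sum k b)]
  rw [actR_sum k _ _ _ _ _ (comul_tmul_sum k a' b _ _ _ _ _ _ (ℛ k a').eq.symm (ℛ k b).eq.symm)]
  simp only [map_sum, map_smul]
  rw [Finset.sum_product, Finset.sum_sigma]
  refine Finset.sum_congr rfl fun i _ => ?_
  simp only [Finset.sum_sigma]
  rw [Finset.sum_comm]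
  refine Finset.sum_congr rfl fun j _ => ?_
  rw [actL_sum k _ _ _ _ _ (comul_tmul_sum k _ _ _ _ _ _ _ _
    (ℛ k ((ℛ k a').left i)).eq.symm (ℛ k ((ℛ k b).left j)).eq.symm)]
  rw [Finset.sum_product]
  simp only [map_sum, map_smul, Finset.smul_sum]
  refine Finset.sum_congr rfl fun _ _ => Finset.sum_congr rfl fun _ _ => ?_
  simp [sF, tauF, mulAB, smul_smul, mul_comm]

lemma comul_mulAB (a : A) (b : B) (c : A ⊗[k] B) {ι κ : Type} (s : Finset ι) (t : Finset κ)
    (u v : ι → A) (pb q : κ → B)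
    (ha : comul (R := k) a = ∑ i ∈ s, u i ⊗ₜ[k] v i)
    (hb : comul (R := k) b = ∑ j ∈ t, pb j ⊗ₜ[k] q j) :
    comul (R := k) (mulAB k a b c) = ∑ i ∈ s, ∑ j ∈ t,
      TensorProduct.map (mulAB k (u i) (pb j)) (mulAB k (v i) (q j)) (comul (R := k) c) := by
  induction c with
  | zero => simp
  | add x y hx hy => simp only [map_add, hx, hy, Finset.sum_add_distrib]
  | tmul x y =>
    have hx := (ℛ k x).eq.symm
    have hy := (ℛ k y).eq.symm
    have e1 : comul (R := k) (a * x) = ∑ z ∈ s ×ˢ (ℛ k x).index,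
        (u z.1 * (ℛ k x).left z.2) ⊗ₜ[k] (v z.1 * (ℛ k x).right z.2) := by
      rw [Bialgebra.comul_mul, ha, Finset.sum_product]
      conv_lhs => rw [hx]
      simp [Finset.sum_mul_sum]
    have e2 : comul (R := k) (y * b) = ∑ z ∈ (ℛ k y).index ×ˢ t,
        ((ℛ k y).left z.1 * pb z.2) ⊗ₜ[k] ((ℛ k y).right z.1 * q z.2) := by
      rw [Bialgebra.comul_mul, hb, Finset.sum_product]
      conv_lhs => rw [hy]
      simp [Finset.sum_mul_sum]
    have e3 : mulAB k a b (x ⊗ₜ y) = (a * x) ⊗ₜ (y * b) := by simp [mulAB]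
    rw [e3, comul_tmul_sum k _ _ _ _ _ _ _ _ e1 e2, comul_tmul_sum k _ _ _ _ _ _ _ _ hx hy]
    simp only [map_sum, Finset.sum_product, TensorProduct.map_tmul, mulAB,
      LinearMap.mulLeft_apply, LinearMap.mulRight_apply]
    refine Finset.sum_congr rfl fun i _ => ?_
    conv_rhs => rw [Finset.sum_comm]
    refine Finset.sum_congr rfl fun i _ => ?_
    rw [Finset.sum_comm]

lemma conv_eq (p : HopfPairing k A B) (φ : A ≃ₐ[k] A)
    (hφc : ∀ (a : A), Coalgebra.comul (R := k) (φ a)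
      = TensorProduct.map φ.toLinearMap φ.toLinearMap (Coalgebra.comul a))
    (hφe : ∀ (a : A), Coalgebra.counit (R := k) (φ a) = Coalgebra.counit (R := k) a)
    (c : A ⊗[k] B) :
    LinearMap.mul' k k (TensorProduct.map
      (tauF k p ∘ₗ TensorProduct.map φ.toLinearMap LinearMap.id)
      (sF k p φ.toAlgHom) (comul (R := k) c)) = counit (R := k) c := by
  induction c with
  | zero => simp
  | add x y hx hy => simp only [map_add, hx, hy]
  | tmul x y =>
    have hx := (ℛ k x).eq.symm
    have hy := (ℛ k y).eq.symm
    rw [comul_tmul_sum k _ _ _ _ _ _ _ _ hx hy, Finset.sum_product, Finset.sum_comm]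
    have e : ∀ b b' : B, ∑ i ∈ (ℛ k x).index, p.σ (φ ((ℛ k x).left i)) b *
        p.σ (φ ((ℛ k x).right i)) b' = p.σ (φ x) (b * b') := by
      intro b b'
      rw [p.pair_mul_right, hφc]
      conv_rhs => rw [hx]
      simp
    have e2 := HopfAlgebra.sum_mul_antipode_eq_smul (R := k) (ℛ k y)
    simp only [map_sum, TensorProduct.map_tmul, LinearMap.mul'_apply, tauF, sF,
      LinearMap.comp_apply, TensorProduct.lift.tmul, LinearMap.id_apply]
    trans ∑ j ∈ (ℛ k y).index, p.σ (φ x) ((ℛ k y).left j * HopfAlgebra.antipode k ((ℛ k y).right j))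
    · exact Finset.sum_congr rfl fun j _ => e _ _
    · rw [← map_sum, e2, map_smul, p.pair_one_right, hφe, TensorProduct.counit_tmul]

lemma comul_Phi (φ : A ≃ₐ[k] A)
    (hφc : ∀ (a : A), Coalgebra.comul (R := k) (φ a)
      = TensorProduct.map φ.toLinearMap φ.toLinearMap (Coalgebra.comul a))
    (c : A ⊗[k] B) :
    comul (R := k) (TensorProduct.map φ.toLinearMap LinearMap.id c) =
    TensorProduct.map (TensorProduct.map φ.toLinearMap LinearMap.id)
      (TensorProduct.map φ.toLinearMap LinearMap.id) (comul (R := k) c) := by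
  induction c with
  | zero => simp
  | add x y hx hy => simp only [map_add, hx, hy]
  | tmul x y =>
    have hx := (ℛ k x).eq.symm
    have hy := (ℛ k y).eq.symm
    have e : comul (R := k) (φ x) = ∑ i ∈ (ℛ k x).index,
        φ ((ℛ k x).left i) ⊗ₜ[k] φ ((ℛ k x).right i) := by
      rw [hφc]
      conv_lhs => rw [hx]
      simp
    rw [comul_tmul_sum k _ _ _ _ _ _ _ _ hx hy, TensorProduct.map_tmul]
    refine (comul_tmul_sum k _ _ _ _ _ _ _ _ e hy).trans ?_
    simp

lemma Phi_mulAB (φ : A ≃ₐ[k] A) (a : A) (b : B) (c : A ⊗[k] B) :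
    TensorProduct.map φ.toLinearMap LinearMap.id (mulAB k a b c) =
      mulAB k (φ a) b (TensorProduct.map φ.toLinearMap LinearMap.id c) := by
  induction c with
  | zero => simp
  | add x y hx hy => simp only [map_add, hx, hy]
  | tmul x y => simp [mulAB]

end Conc

/-- For an action `φ : π → Aut_Hopf(A)`, the comultiplication
`Δ_{α,β}(a ⊗ b) = (φ_β(a₍₁₎) ⊗ b₍₁₎) ⊗ (a₍₂₎ ⊗ b₍₂₎)` is an algebra homomorphism
`D(A,B;σ,φ_{αβ}) → D(A,B;σ,φ_α) ⊗ D(A,B;σ,φ_β)`. -/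
theorem twistedDouble_comul_algHom {A B : Type} [Ring A] [HopfAlgebra k A]
    [Ring B] [HopfAlgebra k B] (p : HopfPairing k A B)
    (π : Type) [Group π] (φ : π →* (A ≃ₐ[k] A))
    (hφc : ∀ (g : π) (a : A), Coalgebra.comul (R := k) (φ g a)
      = TensorProduct.map (φ g).toLinearMap (φ g).toLinearMap (Coalgebra.comul a))
    (hφe : ∀ (g : π) (a : A), Coalgebra.counit (R := k) (φ g a) = Coalgebra.counit (R := k) a)
    (α β : π)
    (m1 m2 m3 : (A ⊗[k] B) →ₗ[k] (A ⊗[k] B) →ₗ[k] (A ⊗[k] B))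
    (hm1 : IsTwistedDoubleMul k p (φ (α * β)).toAlgHom m1)
    (hm2 : IsTwistedDoubleMul k p (φ α).toAlgHom m2)
    (hm3 : IsTwistedDoubleMul k p (φ β).toAlgHom m3)
    (Δ : (A ⊗[k] B) →ₗ[k] (A ⊗[k] B) ⊗[k] (A ⊗[k] B))
    (hΔ : ∀ (a : A) (b : B) (ι κ : Type) (s : Finset ι) (t : Finset κ)
      (u v : ι → A) (pb q : κ → B),
      Coalgebra.comul (R := k) a = ∑ i ∈ s, u i ⊗ₜ[k] v i →
      Coalgebra.comul (R := k) b = ∑ j ∈ t, pb j ⊗ₜ[k] q j →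
      Δ (a ⊗ₜ[k] b) = ∑ i ∈ s, ∑ j ∈ t,
        ((φ β (u i)) ⊗ₜ[k] pb j) ⊗ₜ[k] (v i ⊗ₜ[k] q j))
    (mT : ((A ⊗[k] B) ⊗[k] (A ⊗[k] B)) →ₗ[k] ((A ⊗[k] B) ⊗[k] (A ⊗[k] B)) →ₗ[k]
      ((A ⊗[k] B) ⊗[k] (A ⊗[k] B)))
    (hmT : ∀ (d1 d2 d1' d2' : A ⊗[k] B),
      mT (d1 ⊗ₜ[k] d2) (d1' ⊗ₜ[k] d2') = (m2 d1 d1') ⊗ₜ[k] (m3 d2 d2')) :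
    (∀ x y : A ⊗[k] B, Δ (m1 x y) = mT (Δ x) (Δ y)) ∧
    Δ ((1 : A) ⊗ₜ[k] (1 : B))
      = ((1 : A) ⊗ₜ[k] (1 : B)) ⊗ₜ[k] ((1 : A) ⊗ₜ[k] (1 : B)) := by
  set Φ : A ⊗[k] B →ₗ[k] A ⊗[k] B :=
    TensorProduct.map (φ β).toLinearMap LinearMap.id with hΦ
  have hD : ∀ z, Δ z = TensorProduct.map Φ LinearMap.id (comul (R := k) z) := by
    intro z
    induction z with
    | zero => simp
    | add x y hx hy => simp only [map_add, hx, hy]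
    | tmul x y =>
      rw [hΔ x y _ _ _ _ _ _ _ _ (ℛ k x).eq.symm (ℛ k y).eq.symm,
        comul_tmul_sum k _ _ _ _ _ _ _ _ (ℛ k x).eq.symm (ℛ k y).eq.symm, Finset.sum_product]
      simp [Φ]
  constructor
  · intro x y
    induction x with
    | zero => simp
    | add x x' hx hx' => simp only [map_add, LinearMap.add_apply, hx, hx']
    | tmul a b =>
    induction y with
    | zero => simp
    | add x x' hx hx' => simp only [map_add, hx, hx']
    | tmul a' b' =>
    have ha := (ℛ k a).eq.symm
    have hb := (ℛ k b).eq.symm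
    have ha' := (ℛ k a').eq.symm
    have hb' := (ℛ k b').eq.symm
    have hs : sF k p (φ (α * β)).toAlgHom = sF k p (φ α).toAlgHom ∘ₗ Φ := by
      ext u v
      simp [sF, Φ]
    rw [m_eq k p _ m1 hm1, hD, comul_mulAB k a b' _ _ _ _ _ _ _ ha hb',
      key k _ _ (sF k p (φ β).toAlgHom) _ (conv_eq k p (φ β) (hφc β) (hφe β)),
      comul_tmul_sum k _ _ _ _ _ _ _ _ ha' hb,
      hΔ _ _ _ _ _ _ _ _ _ _ ha hb, hΔ _ _ _ _ _ _ _ _ _ _ ha' hb', ← hΦ, hs]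
    have t1 : ∀ (i j i' j'),
        mT ((φ β ((ℛ k a).left i) ⊗ₜ[k] (ℛ k b).left j) ⊗ₜ[k]
            ((ℛ k a).right i ⊗ₜ[k] (ℛ k b).right j))
          ((φ β ((ℛ k a').left i') ⊗ₜ[k] (ℛ k b').left j') ⊗ₜ[k]
            ((ℛ k a').right i' ⊗ₜ[k] (ℛ k b').right j')) =
        TensorProduct.map Φ LinearMap.id
          (TensorProduct.map (mulAB k ((ℛ k a).left i) ((ℛ k b').left j'))
            (mulAB k ((ℛ k a).right i) ((ℛ k b').right j'))
          (TensorProduct.map (actL k (sF k p (φ α).toAlgHom ∘ₗ Φ) ∘ₗ actR k (tauF k p ∘ₗ Φ))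
            (actR k (tauF k p) ∘ₗ actL k (sF k p (φ β).toAlgHom))
            (((ℛ k a').left i' ⊗ₜ[k] (ℛ k b).left j) ⊗ₜ[k]
              ((ℛ k a').right i' ⊗ₜ[k] (ℛ k b).right j)))) := by
      intro i j i' j'
      have e : φ β ((ℛ k a').left i') ⊗ₜ[k] (ℛ k b).left j =
        Φ ((ℛ k a').left i' ⊗ₜ[k] (ℛ k b).left j) := by simp [Φ]
      rw [hmT, m_eq k p _ m2 hm2, m_eq k p _ m3 hm3, e,
        actR_map k Φ (comul_Phi k _ (hφc β)), actL_map k Φ (comul_Phi k _ (hφc β)),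
        actL_actR k (sF k p (φ β).toAlgHom)]
      simp only [TensorProduct.map_tmul, LinearMap.comp_apply, LinearMap.id_apply]
      rw [hΦ, Phi_mulAB]
    simp only [map_sum, LinearMap.sum_apply, t1, Finset.sum_product]
    symm
    refine (Finset.sum_congr rfl fun i' _ => Finset.sum_comm).trans ?_
    refine Finset.sum_comm.trans ?_
    refine Finset.sum_congr rfl fun i _ => ?_
    exact Finset.sum_comm
  · have h1 : comul (R := k) (1 : A) = ∑ i ∈ (Finset.univ : Finset Unit), (1 : A) ⊗ₜ[k] (1 : A) := by
      simp [Bialgebra.comul_one, Algebra.TensorProduct.one_def]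
    have h2 : comul (R := k) (1 : B) = ∑ i ∈ (Finset.univ : Finset Unit), (1 : B) ⊗ₜ[k] (1 : B) := by
      simp [Bialgebra.comul_one, Algebra.TensorProduct.one_def]
    rw [hΔ 1 1 _ _ _ _ _ _ _ _ h1 h2]
    simp
end

section
/- With the twisted double family D(A,B;σ,φ) = {D(A,B;σ,φ_α)}_{α∈π}, comultiplication Δ_{α,β}(a⊗b) = (φ_β(a_{(1)}) ⊗ b_{(1)}) ⊗ (a_{(2)} ⊗ b_{(2)}), counit ε(a⊗b) = ε_A(a)ε_B(b), and maps S_α(a⊗b) = σ(φ_α(a_{(1)}), b_{(1)}) σ(a_{(3)}, S(b_{(3)})) (φ_α S(a_{(2)}) ⊗ S(b_{(2)})), the antipode equation m_α(S_{α⁻¹} ⊗ id)Δ_{α⁻¹,α}(a⊗b) = ε(a⊗b) 1 holds for all α ∈ π, a ∈ A, b ∈ B. -/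
open TensorProduct Coalgebra

variable (k : Type) [Field k]

lemma td_mon {M : Type} [Monoid M] (a b c d e f : M) (h : d * e = 1) :
    a * (b * c * d) * e * f = a * b * (c * f) := by
  simp only [mul_assoc]
  rw [← mul_assoc d, h, one_mul]

open WithConv in
lemma td_conv3 {A M : Type} [Ring A] [HopfAlgebra k A] [Semiring M] [Algebra k M]
    {ι : Type} (s : Finset ι) (u v w : ι → A) (a : A)
    (h : comul3 k A a = ∑ i ∈ s, (u i ⊗ₜ[k] v i) ⊗ₜ[k] w i)
    (f g l : WithConv (A →ₗ[k] M)) :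
    (f * g * l).ofConv a = ∑ i ∈ s, f.ofConv (u i) * g.ofConv (v i) * l.ofConv (w i) := by
  have h1 : (f * g * l).ofConv a = (LinearMap.mul' k M ∘ₗ TensorProduct.map
      (LinearMap.mul' k M ∘ₗ TensorProduct.map f.ofConv g.ofConv) l.ofConv) (comul3 k A a) := by
    simp only [LinearMap.convMul_def, comul3, LinearMap.comp_apply, LinearMap.rTensor]
    rw [← LinearMap.comp_apply (TensorProduct.map _ _) (TensorProduct.map _ _),
      ← TensorProduct.map_comp]
    rfl
  rw [h1, h]
  simp

lemma td_repr3 {A : Type} [Ring A] [HopfAlgebra k A] (t : (A ⊗[k] A) ⊗[k] A) :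
    ∃ (ι : Type) (s : Finset ι) (u v w : ι → A),
      t = ∑ i ∈ s, (u i ⊗ₜ[k] v i) ⊗ₜ[k] w i := by
  induction t using TensorProduct.induction_on with
  | zero => exact ⟨Empty, ∅, fun _ => 0, fun _ => 0, fun _ => 0, by simp⟩
  | tmul x y =>
    induction x using TensorProduct.induction_on with
    | zero => exact ⟨Empty, ∅, fun _ => 0, fun _ => 0, fun _ => 0, by simp⟩
    | tmul a b => exact ⟨Unit, {()}, fun _ => a, fun _ => b, fun _ => y, by simp⟩
    | add x z hx hz =>
      obtain ⟨ι, s, u, v, w, h⟩ := hx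
      obtain ⟨ι', s', u', v', w', h'⟩ := hz
      exact ⟨ι ⊕ ι', s.disjSum s', Sum.elim u u', Sum.elim v v', Sum.elim w w', by
        simp [Finset.sum_disjSum, TensorProduct.add_tmul, h, h']⟩
  | add x z hx hz =>
    obtain ⟨ι, s, u, v, w, h⟩ := hx
    obtain ⟨ι', s', u', v', w', h'⟩ := hz
    exact ⟨ι ⊕ ι', s.disjSum s', Sum.elim u u', Sum.elim v v', Sum.elim w w', by
      simp [Finset.sum_disjSum, h, h']⟩

open WithConv HopfAlgebra in
lemma td_comul_antipode {B : Type} [Ring B] [HopfAlgebra k B] :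
    comul ∘ₗ antipode k (A := B) = TensorProduct.map (antipode k) (antipode k) ∘ₗ
      (TensorProduct.comm k B B).toLinearMap ∘ₗ comul := by
  apply WithConv.toConv_injective
  symm
  apply left_inv_eq_right_inv (a := toConv (comul (R := k) (A := B))) ?_
    LinearMap.comul_right_inv
  let iL : B →ₐ[k] B ⊗[k] B := Algebra.TensorProduct.includeLeft
  let iR : B →ₐ[k] B ⊗[k] B := Algebra.TensorProduct.includeRight
  have e1 : toConv (TensorProduct.map (antipode k) (antipode k) ∘ₗ
      (TensorProduct.comm k B B).toLinearMap ∘ₗ comul (R := k) (A := B)) =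
      toConv (iR.toLinearMap ∘ₗ antipode k) * toConv (iL.toLinearMap ∘ₗ antipode k) := by
    ext b
    rw [(ℛ k b).convMul_apply]
    simp [iL, iR, ← (ℛ k b).eq]
  have e2 : toConv (comul (R := k) (A := B)) =
      toConv (iL.toLinearMap ∘ₗ LinearMap.id) * toConv (iR.toLinearMap ∘ₗ LinearMap.id) := by
    ext b
    rw [(ℛ k b).convMul_apply]
    simp [iL, iR, (ℛ k b).eq]
  have e3 (i : B →ₐ[k] B ⊗[k] B) : toConv (i.toLinearMap ∘ₗ antipode k) *
      toConv (i.toLinearMap ∘ₗ LinearMap.id) = 1 := by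
    have := LinearMap.algHom_comp_convMul_distrib i (toConv (antipode k)) (toConv LinearMap.id)
    rw [LinearMap.antipode_mul_id] at this
    apply WithConv.ofConv_injective
    rw [ofConv_toConv] at this
    refine Eq.trans this.symm ?_
    ext b
    simp
  rw [e1, e2, mul_assoc, ← mul_assoc (toConv (iL.toLinearMap ∘ₗ antipode k)), e3, one_mul, e3]

open HopfAlgebra in
lemma td_comul3_antipode {B : Type} [Ring B] [HopfAlgebra k B] (b : B)
    {ι : Type} (s : Finset ι) (u v w : ι → B)
    (h : comul3 k B b = ∑ i ∈ s, (u i ⊗ₜ[k] v i) ⊗ₜ[k] w i) :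
    comul3 k B (antipode k b) = ∑ i ∈ s,
      (antipode k (w i) ⊗ₜ[k] antipode k (v i)) ⊗ₜ[k] antipode k (u i) := by
  have hc (x : B) : comul (R := k) (antipode k x) = _ :=
    LinearMap.congr_fun (td_comul_antipode k (B := B)) x
  have h' : (LinearMap.lTensor B (comul (R := k) (A := B))) (comul (R := k) b) =
      ∑ i ∈ s, u i ⊗ₜ[k] (v i ⊗ₜ[k] w i) := by
    rw [← Coalgebra.coassoc_apply]
    change TensorProduct.assoc k B B B (comul3 k B b) = _
    rw [h]; simp
  let T : B ⊗[k] (B ⊗[k] B) →ₗ[k] (B ⊗[k] B) ⊗[k] B :=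
    TensorProduct.map (TensorProduct.map (antipode k) (antipode k) ∘ₗ
      (TensorProduct.comm k B B).toLinearMap) (antipode k) ∘ₗ
      (TensorProduct.comm k B (B ⊗[k] B)).toLinearMap
  have : comul3 k B (antipode k b) =
      T ((LinearMap.lTensor B (comul (R := k) (A := B))) (comul (R := k) b)) := by
    rw [comul3, LinearMap.comp_apply, hc]
    simp only [LinearMap.comp_apply]
    generalize comul (R := k) b = z
    induction z using TensorProduct.induction_on with
    | zero => simp
    | tmul x y => simp [T, hc]
    | add x y hx hy => simp only [map_add, hx, hy]
  rw [this, h']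
  simp [T]

open WithConv HopfAlgebra in
lemma td_phi_antipode {A : Type} [Ring A] [HopfAlgebra k A] (f : A →ₐ[k] A)
    (hc : ∀ a : A, comul (R := k) (f a)
      = TensorProduct.map f.toLinearMap f.toLinearMap (comul a))
    (he : ∀ a : A, counit (R := k) (f a) = counit (R := k) a) (a : A) :
    antipode k (f a) = f (antipode k a) := by
  have key : f.toLinearMap ∘ₗ antipode k = antipode k ∘ₗ f.toLinearMap := by
    apply WithConv.toConv_injective
    apply left_inv_eq_right_inv (a := (toConv f.toLinearMap : WithConv (A →ₗ[k] A)))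
    · ext a
      refine ((ℛ k a).convMul_apply _ _).trans ?_
      simp [← map_mul, ← map_sum, sum_antipode_mul_eq_algebraMap_counit]
    · let c : A →ₗc[k] A := { f.toLinearMap with
        counit_comp := by ext a; exact he a
        map_comp_comul := by ext a; exact (hc a).symm }
      have := LinearMap.convMul_comp_coalgHom_distrib (toConv LinearMap.id)
        (toConv (antipode k (A := A))) c
      rw [LinearMap.id_mul_antipode] at this
      apply WithConv.ofConv_injective
      refine Eq.trans this.symm ?_
      ext a
      change algebraMap k A (counit (f a)) = algebraMap k A (counit a)
      rw [he]
  exact (LinearMap.congr_fun key a).symm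

open WithConv HopfAlgebra in
/-- The key computation on the `B` side. -/
lemma td_key {B W : Type} [Ring B] [HopfAlgebra k B] [Ring W] [Algebra k W]
    (s t : B →ₐ[k] W) (S I : W) (hSI : S * I = 1) (b : B)
    {κ : Type} (J : Finset κ) (p q : κ → B) (hb : comul (R := k) b = ∑ j ∈ J, p j ⊗ₜ[k] q j)
    {L : κ → Type} (K : ∀ j, Finset (L j)) (p1 p2 p3 : ∀ j, L j → B)
    (hp : ∀ j, comul3 k B (p j) = ∑ l ∈ K j, (p1 j l ⊗ₜ[k] p2 j l) ⊗ₜ[k] p3 j l)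
    {N : ∀ j, L j → Type} (Q : ∀ j l, Finset (N j l)) (x y z : ∀ j l, N j l → B)
    (hx : ∀ j l, comul3 k B (p2 j l) =
      ∑ n ∈ Q j l, (x j l n ⊗ₜ[k] y j l n) ⊗ₜ[k] z j l n) :
    ∑ j ∈ J, ∑ l ∈ K j, ∑ n ∈ Q j l,
      ((s (p1 j l) * S * t (antipode k (p3 j l))) *
        (t (antipode k (antipode k (z j l n))) * I * s (antipode k (x j l n)))) ⊗ₜ[k]
        (antipode k (y j l n) * q j) = counit (R := k) b • ((1 : W) ⊗ₜ[k] (1 : B)) := by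
  let iE : (Module.End k W) →ₐ[k] (Module.End k W) ⊗[k] B := Algebra.TensorProduct.includeLeft
  let iB : B →ₐ[k] (Module.End k W) ⊗[k] B := Algebra.TensorProduct.includeRight
  let ml : W →ₗ[k] (Module.End k W) := LinearMap.mul k W
  let mr : W →ₗ[k] (Module.End k W) := (LinearMap.mul k W).flip
  let f1 : WithConv (B →ₗ[k] (Module.End k W) ⊗[k] B) := toConv (iE.toLinearMap ∘ₗ ml ∘ₗ s.toLinearMap)
  let f2 : WithConv (B →ₗ[k] (Module.End k W) ⊗[k] B) :=
    toConv (iE.toLinearMap ∘ₗ mr ∘ₗ s.toLinearMap ∘ₗ antipode k)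
  let f3 : WithConv (B →ₗ[k] (Module.End k W) ⊗[k] B) :=
    toConv (TensorProduct.mk k (Module.End k W) B (mr I) ∘ₗ antipode k)
  let f4 : WithConv (B →ₗ[k] (Module.End k W) ⊗[k] B) :=
    toConv (iE.toLinearMap ∘ₗ mr ∘ₗ t.toLinearMap ∘ₗ antipode k ∘ₗ antipode k)
  let f5 : WithConv (B →ₗ[k] (Module.End k W) ⊗[k] B) :=
    toConv (iE.toLinearMap ∘ₗ mr ∘ₗ t.toLinearMap ∘ₗ antipode k)
  let f6 : WithConv (B →ₗ[k] (Module.End k W) ⊗[k] B) := toConv iB.toLinearMap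
  let θ : (Module.End k W) ⊗[k] B →ₗ[k] W ⊗[k] B := LinearMap.rTensor B (LinearMap.applyₗ (R := k) S)
  have h45 : f4 * f5 = 1 := by
    ext c
    rw [(ℛ k c).convMul_apply]
    have h0 : ∑ i ∈ (ℛ k c).index, mr (t (antipode k (antipode k ((ℛ k c).left i)))) *
        mr (t (antipode k ((ℛ k c).right i))) = algebraMap k (Module.End k W) (counit c) := by
      have h1 := congrArg (fun v => mr (t (antipode k v)))
        (sum_antipode_mul_eq_algebraMap_counit (ℛ k c))
      simp only [map_sum, antipode_mul_antidistrib, Algebra.algebraMap_eq_smul_one, map_smul,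
        antipode_one, map_one] at h1
      have h2 : mr 1 = 1 := by ext; simp [mr]
      rw [h2, ← Algebra.algebraMap_eq_smul_one] at h1
      rw [← h1]
      refine Finset.sum_congr rfl fun i _ => ?_
      ext w
      simp [mr, mul_assoc]
    have h3 := congrArg iE h0
    simp only [map_sum, map_mul] at h3
    simpa [f4, f5] using h3
  have h36 : f3 * f6 = toConv (iE.toLinearMap ∘ₗ LinearMap.toSpanSingleton k (Module.End k W) (mr I) ∘ₗ counit) := by
    ext c
    rw [(ℛ k c).convMul_apply]
    have h1 := congrArg (fun v => (mr I) ⊗ₜ[k] v)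
        (sum_antipode_mul_eq_smul (ℛ k c))
    simp only [TensorProduct.tmul_sum] at h1
    simpa [f3, f6, iE, iB, TensorProduct.smul_tmul] using h1
  have hmain : f1 * (f2 * f3 * f4) * f5 * f6 = f1 * f2 * (f3 * f6) := by
    exact td_mon f1 f2 f3 f4 f5 f6 h45
  have hR : θ ((f1 * f2 * (f3 * f6)).ofConv b) = counit (R := k) b • ((1 : W) ⊗ₜ[k] (1 : B)) := by
    rw [h36]
    have h12 : f1 * f2 * toConv (iE.toLinearMap ∘ₗ
        LinearMap.toSpanSingleton k (Module.End k W) (mr I) ∘ₗ counit)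
        = toConv (LinearMap.mulRight k (iE (mr I)) ∘ₗ (f1 * f2).ofConv) := by
      have h0 : toConv (iE.toLinearMap ∘ₗ
          LinearMap.toSpanSingleton k (Module.End k W) (mr I) ∘ₗ counit) = toConv
          (LinearMap.mulRight k (iE (mr I)) ∘ₗ
            (1 : WithConv (B →ₗ[k] (Module.End k W) ⊗[k] B)).ofConv) := by
        ext c
        simp [Algebra.algebraMap_eq_smul_one]
      rw [h0]
      conv_rhs => rw [← mul_one (f1 * f2)]
      generalize f1 * f2 = g
      generalize (1 : WithConv (B →ₗ[k] (Module.End k W) ⊗[k] B)) = g'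
      ext c
      have e1 := (ℛ k c).convMul_apply g (toConv (LinearMap.mulRight k (iE (mr I)) ∘ₗ g'.ofConv))
      have e2 := (ℛ k c).convMul_apply g g'
      rw [e1]
      simp only [LinearMap.comp_apply, LinearMap.mulRight_apply, e2, Finset.sum_mul, mul_assoc]
    rw [h12]
    have e2 := (ℛ k b).convMul_apply f1 f2
    have e3 := congrArg (fun v => s v ⊗ₜ[k] (1 : B)) (sum_mul_antipode_eq_smul (ℛ k b))
    simp only [LinearMap.comp_apply, LinearMap.mulRight_apply, e2, map_sum]
    simp only [map_sum, TensorProduct.sum_tmul, map_smul, map_one, map_mul] at e3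
    rw [TensorProduct.smul_tmul', ← e3]
    refine Finset.sum_congr rfl fun i _ => ?_
    simp [f1, f2, iE, θ, ml, mr, hSI]
  rw [← hR, ← hmain]
  let 𝓡 : Coalgebra.Repr k b κ := ⟨J, p, q, hb.symm⟩
  have h1 : (f1 * (f2 * f3 * f4) * f5 * f6).ofConv b = _ := 𝓡.convMul_apply _ f6
  rw [h1, map_sum]
  refine Finset.sum_congr rfl fun j _ => ?_
  change _ = θ ((f1 * (f2 * f3 * f4) * f5).ofConv (p j) * f6.ofConv (q j))
  rw [td_conv3 k _ _ _ _ _ (hp j), Finset.sum_mul, map_sum]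
  refine Finset.sum_congr rfl fun l _ => ?_
  rw [td_conv3 k _ _ _ _ _ (hx j l), Finset.mul_sum, Finset.sum_mul, Finset.sum_mul, map_sum]
  refine Finset.sum_congr rfl fun n _ => ?_
  simp [f1, f2, f3, f4, f5, f6, iE, iB, θ, ml, mr, mul_assoc]

open WithConv in
/-- Left pairing as an algebra map into the convolution algebra. -/
noncomputable def tdPair {A B : Type} [Ring A] [HopfAlgebra k A]
    [Ring B] [HopfAlgebra k B] (p : HopfPairing k A B) (f : A →ₗ[k] A)
    (hc : ∀ a : A, comul (R := k) (f a) = TensorProduct.map f f (comul a))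
    (he : ∀ a : A, counit (R := k) (f a) = counit (R := k) a) :
    B →ₐ[k] WithConv (A →ₗ[k] A) :=
  AlgHom.ofLinearMap
    { toFun := fun b => toConv (Algebra.linearMap k A ∘ₗ p.σ.flip b ∘ₗ f)
      map_add' := fun x y => by ext a; simp
      map_smul' := fun c x => by ext a; simp [Algebra.algebraMap_eq_smul_one, mul_smul] }
    (by ext a; simp [p.pair_one_right, he])
    (by
      intro x y
      ext a
      refine Eq.trans ?_ ((ℛ k a).convMul_apply _ _).symm
      simp only [LinearMap.coe_mk, AddHom.coe_mk, LinearMap.comp_apply, LinearMap.flip_apply,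
        p.pair_mul_right, hc]
      rw [← (ℛ k a).eq]
      simp)

open WithConv in
lemma tdPair_apply {A B : Type} [Ring A] [HopfAlgebra k A]
    [Ring B] [HopfAlgebra k B] (p : HopfPairing k A B) (f : A →ₗ[k] A)
    (hc : ∀ a : A, comul (R := k) (f a) = TensorProduct.map f f (comul a))
    (he : ∀ a : A, counit (R := k) (f a) = counit (R := k) a) (b : B) (a : A) :
    (tdPair k p f hc he b).ofConv a = algebraMap k A (p.σ (f a) b) := rfl

/-- The antipode equation `m_α (S_{α⁻¹} ⊗ id) Δ_{α⁻¹,α} (a ⊗ b) = ε(a ⊗ b) 1` in the twisted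
double Hopf `π`-coalgebra `D(A,B;σ,φ)`. -/
theorem twistedDouble_antipode_eq {A B : Type} [Ring A] [HopfAlgebra k A]
    [Ring B] [HopfAlgebra k B] (p : HopfPairing k A B)
    (π : Type) [Group π] (φ : π →* (A ≃ₐ[k] A))
    (hφc : ∀ (g : π) (a : A), Coalgebra.comul (R := k) (φ g a)
      = TensorProduct.map (φ g).toLinearMap (φ g).toLinearMap (Coalgebra.comul a))
    (hφe : ∀ (g : π) (a : A), Coalgebra.counit (R := k) (φ g a) = Coalgebra.counit (R := k) a)
    (α : π)
    (mα : (A ⊗[k] B) →ₗ[k] (A ⊗[k] B) →ₗ[k] (A ⊗[k] B))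
    (hmα : IsTwistedDoubleMul k p (φ α).toAlgHom mα)
    (Δ' : (A ⊗[k] B) →ₗ[k] (A ⊗[k] B) ⊗[k] (A ⊗[k] B))
    (hΔ' : ∀ (a : A) (b : B) (ι κ : Type) (s : Finset ι) (t : Finset κ)
      (u v : ι → A) (pb q : κ → B),
      Coalgebra.comul (R := k) a = ∑ i ∈ s, u i ⊗ₜ[k] v i →
      Coalgebra.comul (R := k) b = ∑ j ∈ t, pb j ⊗ₜ[k] q j →
      Δ' (a ⊗ₜ[k] b) = ∑ i ∈ s, ∑ j ∈ t,
        ((φ α (u i)) ⊗ₜ[k] pb j) ⊗ₜ[k] (v i ⊗ₜ[k] q j))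
    (Sm : (A ⊗[k] B) →ₗ[k] (A ⊗[k] B))
    (hSm : ∀ (a : A) (b : B) (ι κ : Type) (s : Finset ι) (t : Finset κ)
      (u v w : ι → A) (pb q r : κ → B),
      comul3 k A a = ∑ i ∈ s, (u i ⊗ₜ[k] v i) ⊗ₜ[k] w i →
      comul3 k B b = ∑ j ∈ t, (pb j ⊗ₜ[k] q j) ⊗ₜ[k] r j →
      Sm (a ⊗ₜ[k] b) = ∑ i ∈ s, ∑ j ∈ t,
        (p.σ (φ α⁻¹ (u i)) (pb j) * p.σ (w i) (HopfAlgebra.antipode (R := k) (r j))) •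
          ((φ α⁻¹ (HopfAlgebra.antipode (R := k) (v i))) ⊗ₜ[k]
            (HopfAlgebra.antipode (R := k) (q j)))) :
    ∀ (a : A) (b : B),
      TensorProduct.lift mα (TensorProduct.map Sm LinearMap.id (Δ' (a ⊗ₜ[k] b)))
        = (Coalgebra.counit (R := k) a * Coalgebra.counit (R := k) b) •
            ((1 : A) ⊗ₜ[k] (1 : B)) := by
  intro a b
  classical
  let Sw : WithConv (A →ₗ[k] A) := WithConv.toConv (HopfAlgebra.antipode k)
  let Iw : WithConv (A →ₗ[k] A) := WithConv.toConv LinearMap.id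
  let s : B →ₐ[k] WithConv (A →ₗ[k] A) := tdPair k p LinearMap.id (by simp) (by simp)
  let t : B →ₐ[k] WithConv (A →ₗ[k] A) :=
    tdPair k p (φ α).toLinearMap (hφc α) (hφe α)
  have hs (y : B) (x : A) : (s y).ofConv x = algebraMap k A (p.σ x y) := rfl
  have ht (y : B) (x : A) : (t y).ofConv x = algebraMap k A (p.σ (φ α x) y) := rfl
  have hinv (x : A) : φ α⁻¹ (φ α x) = x := by
    rw [← AlgEquiv.mul_apply, ← map_mul]; simp
  have hm : ∀ (x a' : A) (y y' : B) (κ : Type) (J : Finset κ) (p1 p2 p3 : κ → B),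
      comul3 k B y = ∑ j ∈ J, (p1 j ⊗ₜ[k] p2 j) ⊗ₜ[k] p3 j →
      mα (x ⊗ₜ[k] y) (a' ⊗ₜ[k] y') = ∑ j ∈ J,
        (x * (t (HopfAlgebra.antipode k (p1 j)) * Iw * s (p3 j)).ofConv a') ⊗ₜ[k]
          (p2 j * y') := by
    intro x a' y y' κ J p1 p2 p3 h
    obtain ⟨ι, I, u, v, w, hu⟩ := td_repr3 k (comul3 k A a')
    rw [hmα x a' y y' ι κ I J u v w p1 p2 p3 hu h, Finset.sum_comm]
    refine Finset.sum_congr rfl fun j _ => ?_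
    rw [td_conv3 k I u v w a' hu, Finset.mul_sum, TensorProduct.sum_tmul]
    refine Finset.sum_congr rfl fun i _ => ?_
    rw [hs, ht, TensorProduct.smul_tmul']
    congr 1
    simp only [Iw, Algebra.algebraMap_eq_smul_one]
    simp [smul_smul, mul_comm]
  have hS : ∀ (x : A) (y : B) (κ : Type) (J : Finset κ) (p1 p2 p3 : κ → B),
      comul3 k B y = ∑ j ∈ J, (p1 j ⊗ₜ[k] p2 j) ⊗ₜ[k] p3 j →
      Sm (φ α x ⊗ₜ[k] y) = ∑ j ∈ J,
        ((s (p1 j) * Sw * t (HopfAlgebra.antipode k (p3 j))).ofConv x) ⊗ₜ[k]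
          (HopfAlgebra.antipode k (p2 j)) := by
    intro x y κ J p1 p2 p3 h
    obtain ⟨ι, I, u, v, w, hu⟩ := td_repr3 k (comul3 k A x)
    have hu' : comul3 k A (φ α x) =
        ∑ i ∈ I, (φ α (u i) ⊗ₜ[k] φ α (v i)) ⊗ₜ[k] φ α (w i) := by
      have : comul3 k A (φ α x) = TensorProduct.map (TensorProduct.map (φ α).toLinearMap
          (φ α).toLinearMap) (φ α).toLinearMap (comul3 k A x) := by
        rw [comul3, LinearMap.comp_apply, LinearMap.comp_apply, hφc, ← (ℛ k x).eq]
        simp [hφc]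
      rw [this, hu]
      simp
    rw [hSm _ y ι κ I J _ _ _ p1 p2 p3 hu' h, Finset.sum_comm]
    refine Finset.sum_congr rfl fun j _ => ?_
    rw [td_conv3 k I u v w x hu, TensorProduct.sum_tmul]
    refine Finset.sum_congr rfl fun i _ => ?_
    have ha : HopfAlgebra.antipode k (φ α (v i)) = φ α (HopfAlgebra.antipode k (v i)) :=
      td_phi_antipode k (φ α).toAlgHom (hφc α) (hφe α) (v i)
    rw [hs, ht, TensorProduct.smul_tmul', hinv, ha, hinv]
    congr 1
    simp only [Sw, Algebra.algebraMap_eq_smul_one]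
    simp [smul_smul, mul_comm]
  choose L K p1 p2 p3 hp using fun y : B => td_repr3 k (comul3 k B y)
  let 𝓡 := ℛ k b
  let 𝓐 := ℛ k a
  have hSI : Sw * Iw = 1 := LinearMap.antipode_mul_id
  have key := td_key k s t Sw Iw hSI b 𝓡.index 𝓡.left 𝓡.right 𝓡.eq.symm
    (fun j => K (𝓡.left j)) (fun j => p1 (𝓡.left j)) (fun j => p2 (𝓡.left j))
    (fun j => p3 (𝓡.left j)) (fun j => hp _)
    (fun j l => K (p2 (𝓡.left j) l)) (fun j l => p1 (p2 (𝓡.left j) l))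
    (fun j l => p2 (p2 (𝓡.left j) l)) (fun j l => p3 (p2 (𝓡.left j) l)) (fun j l => hp _)
  let ev : WithConv (A →ₗ[k] A) →ₗ[k] A :=
    LinearMap.applyₗ (R := k) a ∘ₗ (WithConv.linearEquiv k (A →ₗ[k] A)).toLinearMap
  have hev (f : WithConv (A →ₗ[k] A)) : ev f = f.ofConv a := rfl
  have key2 := congrArg (LinearMap.rTensor B ev) key
  simp only [map_sum, LinearMap.rTensor_tmul, map_smul, hev] at key2
  rw [LinearMap.convOne_apply, Algebra.algebraMap_eq_smul_one, ← TensorProduct.smul_tmul',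
    smul_smul, mul_comm (counit b)] at key2
  rw [← key2, hΔ' a b _ _ 𝓐.index 𝓡.index 𝓐.left 𝓐.right 𝓡.left 𝓡.right 𝓐.eq.symm 𝓡.eq.symm,
    Finset.sum_comm]
  simp only [map_sum, TensorProduct.map_tmul, TensorProduct.lift.tmul, LinearMap.id_apply]
  refine Finset.sum_congr rfl fun j _ => ?_
  have h1 : ∀ i ∈ 𝓐.index, mα (Sm (φ α (𝓐.left i) ⊗ₜ[k] 𝓡.left j)) (𝓐.right i ⊗ₜ[k] 𝓡.right j)
      = ∑ l ∈ K (𝓡.left j), ∑ n ∈ K (p2 (𝓡.left j) l),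
        ((s (p1 (𝓡.left j) l) * Sw *
            t (HopfAlgebra.antipode k (p3 (𝓡.left j) l))).ofConv (𝓐.left i) *
          (t (HopfAlgebra.antipode k (HopfAlgebra.antipode k (p3 (p2 (𝓡.left j) l) n))) * Iw *
            s (HopfAlgebra.antipode k (p1 (p2 (𝓡.left j) l) n))).ofConv (𝓐.right i)) ⊗ₜ[k]
          (HopfAlgebra.antipode k (p2 (p2 (𝓡.left j) l) n) * 𝓡.right j) := by
    intro i _
    rw [hS _ _ _ _ _ _ _ (hp _), map_sum, LinearMap.sum_apply]
    refine Finset.sum_congr rfl fun l _ => ?_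
    exact hm _ _ _ _ _ _ _ _ _ (td_comul3_antipode k _ _ _ _ _ (hp _))
  rw [Finset.sum_congr rfl h1, Finset.sum_comm]
  refine Finset.sum_congr rfl fun l _ => ?_
  rw [Finset.sum_comm]
  refine Finset.sum_congr rfl fun n _ => ?_
  rw [← TensorProduct.sum_tmul]
  congr 1
  exact (𝓐.convMul_apply _ _).symm
end
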